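/- Let 0 < α < 1 and let p : (0,∞) × [0,∞) → ℝ, (t,x) ↦ p_t(x), be a measurable family of nonnegative functions such that for every v > 0 and t > 0, ∫₀^∞ e^{−v x} p_t(x) dx = E_α(−v t^α), and such that for each fixed w > 0 the function x ↦ ∫₀^∞ e^{−wt} p_t(x) dt is continuous and of at most exponential growth. Then for every w > 0 and every x ≥ 0, ∫₀^∞ e^{−w t} p_t(x) dt = w^{α−1} e^{−x w^α}. -/

import Mathlib

open MeasureTheory Set

/-- The one-parameter Mittag-Leffler function `E_α(z) = ∑ zⁿ / Γ(αn+1)`. -/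
noncomputable def mittagLeffler (α z : ℝ) : ℝ :=
  ∑' n : ℕ, z ^ n / Real.Gamma (α * n + 1)

open ProbabilityTheory in
lemma ext_of_mgf_near (μ μ' : Measure ℝ) [IsFiniteMeasure μ] [IsFiniteMeasure μ'] (a : ℝ)
    (ha : 0 < a)
    (h1 : ∀ t ∈ Ioo (-a) a, Integrable (fun x : ℝ => Real.exp (t * x)) μ)
    (h2 : ∀ t ∈ Ioo (-a) a, Integrable (fun x : ℝ => Real.exp (t * x)) μ')
    (h : ∀ t ∈ Ioo (-a) a, ∫ x, Real.exp (t * x) ∂μ = ∫ x, Real.exp (t * x) ∂μ') :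
    μ = μ' := by
  have i1 : Ioo (-a) a ⊆ interior (integrableExpSet id μ) :=
    interior_maximal (fun t ht => h1 t ht) isOpen_Ioo
  have i2 : Ioo (-a) a ⊆ interior (integrableExpSet id μ') :=
    interior_maximal (fun t ht => h2 t ht) isOpen_Ioo
  have hX : AnalyticOnNhd ℂ (complexMGF id μ) {z | z.re ∈ Ioo (-a) a} :=
    analyticOnNhd_complexMGF.mono (fun z hz => i1 hz)
  have hY : AnalyticOnNhd ℂ (complexMGF id μ') {z | z.re ∈ Ioo (-a) a} :=
    analyticOnNhd_complexMGF.mono (fun z hz => i2 hz)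
  have key : Set.EqOn (complexMGF id μ) (complexMGF id μ') {z | z.re ∈ Ioo (-a) a} := by
    refine AnalyticOnNhd.eqOn_of_preconnected_of_frequently_eq hX hY
      ((convex_Ioo (-a) a).linear_preimage Complex.reLm).isPreconnected
      (z₀ := ((0 : ℝ) : ℂ)) (by simp [ha]) ?_
    have h_real : ∃ᶠ (x : ℝ) in nhdsWithin 0 {0}ᶜ, complexMGF id μ x = complexMGF id μ' x := by
      refine Filter.Eventually.frequently ?_
      have : ∀ᶠ x : ℝ in nhds 0, x ∈ Ioo (-a) a := Ioo_mem_nhds (by linarith) ha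
      filter_upwards [nhdsWithin_le_nhds this] with y hy
      rw [complexMGF_ofReal, complexMGF_ofReal]
      congr 1
      exact h y hy
    rw [Filter.frequently_iff_seq_forall] at h_real ⊢
    obtain ⟨xs, hx_tendsto, hx_eq⟩ := h_real
    refine ⟨fun n ↦ xs n, ?_, fun n ↦ ?_⟩
    · rw [tendsto_nhdsWithin_iff] at hx_tendsto ⊢
      constructor
      · exact (Complex.continuous_ofReal.tendsto _).comp hx_tendsto.1
      · simpa using hx_tendsto.2
    · simp [hx_eq]
  apply Measure.ext_of_charFun
  ext t
  rw [← complexMGF_id_mul_I, ← complexMGF_id_mul_I]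
  exact key (by simp [ha])

lemma laplace_unique (f g : ℝ → ℝ) (a : ℝ) (ha : 0 < a)
    (hf0 : ∀ x, 0 < x → 0 ≤ f x) (hg0 : ∀ x, 0 < x → 0 ≤ g x)
    (hf : ∀ v, 0 < v → v < 2 * a → IntegrableOn (fun x => Real.exp (-v * x) * f x) (Ioi 0))
    (hg : ∀ v, 0 < v → v < 2 * a → IntegrableOn (fun x => Real.exp (-v * x) * g x) (Ioi 0))
    (h : ∀ v, 0 < v → v < 2 * a → ∫ x in Ioi (0:ℝ), Real.exp (-v * x) * f x
      = ∫ x in Ioi (0:ℝ), Real.exp (-v * x) * g x) :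
    f =ᵐ[volume.restrict (Ioi 0)] g := by
  set m := (volume.restrict (Ioi (0:ℝ))) with hm
  have aux : ∀ (f : ℝ → ℝ) (hf0 : ∀ x, 0 < x → 0 ≤ f x)
      (hf : ∀ v, 0 < v → v < 2 * a → IntegrableOn (fun x => Real.exp (-v * x) * f x) (Ioi 0)),
      IsFiniteMeasure (m.withDensity (fun x => ENNReal.ofReal (Real.exp (-a * x) * f x))) ∧
      ∀ t ∈ Ioo (-a) a,
        Integrable (fun x : ℝ => Real.exp (t * x))
          (m.withDensity (fun x => ENNReal.ofReal (Real.exp (-a * x) * f x))) ∧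
        ∫ x, Real.exp (t * x) ∂(m.withDensity
            (fun x => ENNReal.ofReal (Real.exp (-a * x) * f x)))
          = ∫ x in Ioi (0:ℝ), Real.exp (-(a - t) * x) * f x := by
    intro f hf0 hf
    have hI := hf a ha (by linarith)
    have hmeas : AEMeasurable (fun x => ENNReal.ofReal (Real.exp (-a * x) * f x)) m :=
      hI.aestronglyMeasurable.aemeasurable.ennreal_ofReal
    refine ⟨isFiniteMeasure_withDensity_ofReal hI.2, fun t ht => ?_⟩
    have e : (fun x => (ENNReal.ofReal (Real.exp (-a * x) * f x)).toReal • Real.exp (t * x))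
        =ᵐ[m] fun x => Real.exp (-(a - t) * x) * f x := by
      filter_upwards [ae_restrict_mem measurableSet_Ioi] with x hx
      have := hf0 x hx
      rw [ENNReal.toReal_ofReal (by positivity), smul_eq_mul,
        show -(a - t) * x = -a * x + t * x by ring, Real.exp_add]
      ring
    constructor
    · rw [integrable_withDensity_iff_integrable_smul₀' hmeas (by simp), integrable_congr e]
      exact hf _ (by linarith [ht.2]) (by linarith [ht.1])
    · rw [integral_withDensity_eq_integral_toReal_smul₀ hmeas (by simp)]
      exact integral_congr_ae e
  obtain ⟨F1, F2⟩ := aux f hf0 hf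
  obtain ⟨G1, G2⟩ := aux g hg0 hg
  have := ext_of_mgf_near _ _ a ha (fun t ht => (F2 t ht).1) (fun t ht => (G2 t ht).1)
    (fun t ht => by
      rw [(F2 t ht).2, (G2 t ht).2]
      exact h _ (by linarith [ht.2]) (by linarith [ht.1]))
  rw [withDensity_eq_iff_of_sigmaFinite
    ((hf a ha (by linarith)).aestronglyMeasurable.aemeasurable.ennreal_ofReal)
    ((hg a ha (by linarith)).aestronglyMeasurable.aemeasurable.ennreal_ofReal)] at this
  filter_upwards [this, ae_restrict_mem measurableSet_Ioi] with x hx hx0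
  have h1 := hf0 x hx0
  have h2 := hg0 x hx0
  rw [ENNReal.ofReal_eq_ofReal_iff (by positivity) (by positivity)] at hx
  exact mul_left_cancel₀ (Real.exp_pos _).ne' hx

lemma laplace_mittagLeffler (α : ℝ) (hα0 : 0 < α) (v w : ℝ) (hv : 0 < v) (hw : 0 < w)
    (hvw : v < w ^ α) :
    ∫ t in Ioi (0:ℝ), Real.exp (-w * t) * mittagLeffler α (-v * t ^ α)
      = w ^ (α - 1) / (w ^ α + v) := by
  have hwa : 0 < w ^ α := Real.rpow_pos_of_pos hw α
  have base : ∀ n : ℕ, ∫ t in Ioi (0:ℝ), t ^ ((α * n + 1) - 1) * Real.exp (-(w * t))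
      = (1 / w) ^ (α * n + 1) * Real.Gamma (α * n + 1) := fun n =>
    Real.integral_rpow_mul_exp_neg_mul_Ioi (by positivity) hw
  have gp : ∀ n : ℕ, 0 < Real.Gamma (α * n + 1) := fun n => Real.Gamma_pos_of_pos (by positivity)
  have baseI : ∀ n : ℕ, IntegrableOn (fun t : ℝ => t ^ ((α * n + 1) - 1) * Real.exp (-(w * t)))
      (Ioi 0) := fun n =>
    .of_integral_ne_zero (by rw [base]; have := gp n; positivity)
  have pw : ∀ n : ℕ, (1 / w) ^ (α * n + 1) = w⁻¹ * ((w ^ α)⁻¹) ^ n := by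
    intro n
    rw [one_div, Real.rpow_add (by positivity), Real.rpow_one, Real.rpow_mul (by positivity),
      Real.rpow_natCast, Real.inv_rpow hw.le, mul_comm]
  set F : ℕ → ℝ → ℝ := fun n t =>
    ((-v) ^ n / Real.Gamma (α * n + 1)) * (t ^ ((α * n + 1) - 1) * Real.exp (-(w * t))) with hF
  have FI : ∀ n, Integrable (F n) (volume.restrict (Ioi 0)) := fun n => (baseI n).const_mul _
  have Fv : ∀ n, ∫ t in Ioi (0:ℝ), F n t = w⁻¹ * (-v / w ^ α) ^ n := by
    intro n
    simp only [hF]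
    rw [integral_const_mul, base, pw, div_pow, inv_pow]
    have := (gp n).ne'
    field_simp
  have Fn : ∀ n, ∫ t in Ioi (0:ℝ), ‖F n t‖ = w⁻¹ * (v / w ^ α) ^ n := by
    intro n
    have : ∫ t in Ioi (0:ℝ), ‖F n t‖ = ∫ t in Ioi (0:ℝ), (v ^ n / Real.Gamma (α * n + 1)) *
        (t ^ ((α * n + 1) - 1) * Real.exp (-(w * t))) := by
      refine setIntegral_congr_fun measurableSet_Ioi (fun t ht => ?_)
      have ht : 0 < t := ht
      simp only [hF, norm_mul, norm_div, norm_pow, norm_neg, Real.norm_eq_abs, abs_of_pos hv,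
        abs_of_pos (gp n), Real.abs_exp, abs_of_pos (Real.rpow_pos_of_pos ht _)]
    rw [this, integral_const_mul, base, pw, div_pow, inv_pow]
    have := (gp n).ne'
    field_simp
  have q : v / w ^ α < 1 := (div_lt_one hwa).2 hvw
  have S := hasSum_integral_of_summable_integral_norm FI (by
    simp_rw [Fn]
    exact (summable_geometric_of_lt_one (by positivity) q).mul_left _)
  simp_rw [Fv] at S
  have S2 : HasSum (fun n : ℕ => w⁻¹ * (-v / w ^ α) ^ n) (w⁻¹ * (1 - (-v / w ^ α))⁻¹) :=
    (hasSum_geometric_of_abs_lt_one (by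
      rw [abs_div, abs_neg, abs_of_pos hv, abs_of_pos hwa]; exact q)).mul_left _
  have E := S.unique S2
  have : ∫ t in Ioi (0:ℝ), Real.exp (-w * t) * mittagLeffler α (-v * t ^ α)
      = ∫ t in Ioi (0:ℝ), ∑' n, F n t := by
    refine setIntegral_congr_fun measurableSet_Ioi (fun t ht => ?_)
    have ht : 0 < t := ht
    simp only [mittagLeffler, hF]
    rw [← tsum_mul_left]
    congr 1
    ext n
    rw [add_sub_cancel_right, mul_pow, Real.rpow_mul ht.le, Real.rpow_natCast, neg_mul]
    ring
  rw [this, E, Real.rpow_sub hw, Real.rpow_one]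
  have : w ^ α + v ≠ 0 := by positivity
  have h3 : 1 - (-v / w ^ α) = (w ^ α + v) / w ^ α := by field_simp; ring
  rw [h3]
  field_simp

/-- if the nonnegative measurable family `p_t` has Laplace transform in `x`
equal to `E_α(−v t^α)`, and the `t`-Laplace transform of `p_t(x)` is continuous and of at
most exponential growth in `x`, then `∫₀^∞ e^{−wt} p_t(x) dt = w^{α−1} e^{−x w^α}`. -/
theorem laplace_internal_time_density (α : ℝ) (hα0 : 0 < α) (hα1 : α < 1)
    (p : ℝ → ℝ → ℝ)
    (hmeas : Measurable (Function.uncurry p))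
    (hnonneg : ∀ t x : ℝ, 0 < t → 0 ≤ x → 0 ≤ p t x)
    (hlap : ∀ v t : ℝ, 0 < v → 0 < t →
      IntegrableOn (fun x : ℝ => Real.exp (-v * x) * p t x) (Ioi 0) ∧
      ∫ x in Ioi (0 : ℝ), Real.exp (-v * x) * p t x = mittagLeffler α (-v * t ^ α))
    (hcont : ∀ w : ℝ, 0 < w →
      ContinuousOn (fun x : ℝ => ∫ t in Ioi (0 : ℝ), Real.exp (-w * t) * p t x) (Ici 0))
    (hgrowth : ∀ w : ℝ, 0 < w → ∃ M c : ℝ, ∀ x : ℝ, 0 ≤ x →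
      |∫ t in Ioi (0 : ℝ), Real.exp (-w * t) * p t x| ≤ M * Real.exp (c * x)) :
    ∀ w x : ℝ, 0 < w → 0 ≤ x →
      ∫ t in Ioi (0 : ℝ), Real.exp (-w * t) * p t x
        = w ^ (α - 1) * Real.exp (-x * w ^ α) := by
  intro w x0 hw hx0
  set F : ℝ → ℝ := fun x => ∫ t in Ioi (0 : ℝ), Real.exp (-w * t) * p t x with hF
  have hwa : 0 < w ^ α := Real.rpow_pos_of_pos hw α
  have main : ∀ v, 0 < v → v < w ^ α →
      IntegrableOn (fun x => Real.exp (-v * x) * F x) (Ioi 0) ∧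
      ∫ x in Ioi (0:ℝ), Real.exp (-v * x) * F x = w ^ (α - 1) / (w ^ α + v) := by
    intro v hv hvw
    have L := laplace_mittagLeffler α hα0 v w hv hw hvw
    have LI : IntegrableOn (fun t => Real.exp (-w * t) * mittagLeffler α (-v * t ^ α)) (Ioi 0) :=
      .of_integral_ne_zero (by rw [L]; have := Real.rpow_pos_of_pos hw (α - 1); positivity)
    set G : ℝ → ℝ → ℝ := fun t x => Real.exp (-v * x) * (Real.exp (-w * t) * p t x) with hG
    have Gm : Measurable (Function.uncurry G) := by
      have : Function.uncurry G = fun z : ℝ × ℝ =>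
        Real.exp (-v * z.2) * (Real.exp (-w * z.1) * Function.uncurry p z) := rfl
      rw [this]
      fun_prop
    have Gint : ∀ t, 0 < t → ∫ x in Ioi (0:ℝ), G t x
        = Real.exp (-w * t) * mittagLeffler α (-v * t ^ α) := by
      intro t ht
      rw [← (hlap v t hv ht).2, ← integral_const_mul]
      congr 1
      ext x
      simp only [hG]
      ring
    have GI : Integrable (Function.uncurry G)
        ((volume.restrict (Ioi 0)).prod (volume.restrict (Ioi 0))) := by
      rw [integrable_prod_iff Gm.aestronglyMeasurable]
      constructor
      · filter_upwards [ae_restrict_mem measurableSet_Ioi] with t ht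
        refine (((hlap v t hv ht).1).const_mul (Real.exp (-w * t))).congr ?_
        refine Filter.Eventually.of_forall fun x => ?_
        simp only [hG, Function.uncurry]
        ring
      · refine LI.congr ?_
        filter_upwards [ae_restrict_mem measurableSet_Ioi] with t ht
        rw [← Gint t ht]
        refine setIntegral_congr_fun measurableSet_Ioi (fun x hx => ?_)
        have := hnonneg t x ht (le_of_lt hx)
        simp only [Function.uncurry, hG]
        rw [Real.norm_of_nonneg (by positivity)]
    have e : ∀ x, ∫ t in Ioi (0:ℝ), G t x = Real.exp (-v * x) * F x := by
      intro x
      simp only [hG, hF]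
      rw [integral_const_mul]
    constructor
    · have := GI.integral_prod_right
      simp only [Function.uncurry, e] at this
      exact this
    · rw [← L, ← setIntegral_congr_fun measurableSet_Ioi (fun t ht => Gint t ht),
        integral_integral_swap GI]
      simp_rw [e]
  have gmain : ∀ v, 0 < v → ∫ x in Ioi (0:ℝ), Real.exp (-v * x) *
      (w ^ (α - 1) * Real.exp (-x * w ^ α)) = w ^ (α - 1) / (w ^ α + v) := by
    intro v hv
    have : ∀ x : ℝ, Real.exp (-v * x) * (w ^ (α - 1) * Real.exp (-x * w ^ α))
        = w ^ (α - 1) * Real.exp (-(w ^ α + v) * x) := by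
      intro x
      rw [show -(w ^ α + v) * x = -v * x + -x * w ^ α by ring, Real.exp_add]
      ring
    simp_rw [this]
    rw [integral_const_mul, integral_exp_mul_Ioi (by linarith)]
    rw [mul_zero, Real.exp_zero, neg_div_neg_eq, mul_one_div]
  have hae := laplace_unique F (fun x => w ^ (α - 1) * Real.exp (-x * w ^ α)) (w ^ α / 2)
    (by positivity)
    (fun x hx => setIntegral_nonneg measurableSet_Ioi (fun t ht => by
      have := hnonneg t x ht hx.le
      positivity))
    (fun x hx => by positivity)
    (fun v h1 h2 => (main v h1 (by linarith)).1)
    (fun v h1 h2 => .of_integral_ne_zero (by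
      rw [gmain v h1]
      have := Real.rpow_pos_of_pos hw (α - 1)
      positivity))
    (fun v h1 h2 => by rw [(main v h1 (by linarith)).2, gmain v h1])
  rw [restrict_Ioi_eq_restrict_Ici] at hae
  exact Measure.eqOn_of_ae_eq hae (hcont w hw) (by fun_prop) (by simp) hx0
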